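/- Let S ∈ ℝ^{N×N} be a graph shift operator, x ∈ ℝ^N a graph signal, and let Φ(x, S, ℋ) be a GNN with L layers, feature dimensions F_0 = 1, F_1, …, F_{L-1}, F_L = 1, filter coefficients ℋ = {h_{ℓ,k}^{fg}} of order K, and pointwise nonlinearity σ : ℝ → ℝ. Then for every N×N permutation matrix P, the GNN is permutation equivariant: Φ(Px, P S Pᵀ, ℋ) = P Φ(x, S, ℋ). -/

import Mathlib

open Matrix

/-- A permutation matrix: `P i j = 1` iff `j = π i` for some permutation `π`. -/
def IsPermMatrix {N : ℕ} (P : Matrix (Fin N) (Fin N) ℝ) : Prop :=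
  ∃ π : Equiv.Perm (Fin N), ∀ i j, P i j = if j = π i then 1 else 0

/-- The features of a GNN: `gnnFeat S σ K F h x ℓ f` is the `f`-th feature signal
of layer `ℓ`, where `S` is the graph shift operator, `σ` the pointwise nonlinearity,
`K` the filter order, `F ℓ` the number of features at layer `ℓ` (with `F 0 = 1`),
`h ℓ f g k` the filter coefficients, and `x` the input graph signal. -/
def gnnFeat {N : ℕ} (S : Matrix (Fin N) (Fin N) ℝ) (σ : ℝ → ℝ) (K : ℕ) (F : ℕ → ℕ)
    (h : ℕ → ℕ → ℕ → ℕ → ℝ) (x : Fin N → ℝ) : ℕ → ℕ → Fin N → ℝ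
  | 0, _ => x
  | ℓ + 1, f => fun i =>
      σ ((∑ g ∈ Finset.range (F ℓ), ∑ k ∈ Finset.range (K + 1),
            h (ℓ + 1) f g k • (S ^ k).mulVec (gnnFeat S σ K F h x ℓ g)) i)

/-- The GNN output `Φ(x, S, ℋ)`: the single feature of the last layer `L`. -/
def gnnOutput {N : ℕ} (S : Matrix (Fin N) (Fin N) ℝ) (σ : ℝ → ℝ) (K L : ℕ) (F : ℕ → ℕ)
    (h : ℕ → ℕ → ℕ → ℕ → ℝ) (x : Fin N → ℝ) : Fin N → ℝ :=
  gnnFeat S σ K F h x L 0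

theorem mulVec_eq_comp_of_perm {N : ℕ} {P : Matrix (Fin N) (Fin N) ℝ} {π : Equiv.Perm (Fin N)}
    (hπ : ∀ i j, P i j = if j = π i then 1 else 0) (v : Fin N → ℝ) :
    P.mulVec v = v ∘ π := by
  funext i
  simp [Matrix.mulVec, dotProduct, hπ]

theorem IsPermMatrix.transpose_mul_self {N : ℕ} {P : Matrix (Fin N) (Fin N) ℝ}
    (hP : IsPermMatrix P) : Pᵀ * P = 1 := by
  obtain ⟨π, hπ⟩ := hP
  refine mul_eq_one_comm.mp ?_
  ext i j
  simp [Matrix.mul_apply, hπ, Matrix.one_apply, eq_comm]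

theorem conj_pow_mulVec {N : ℕ} {P : Matrix (Fin N) (Fin N) ℝ} (hP : Pᵀ * P = 1)
    (S : Matrix (Fin N) (Fin N) ℝ) (k : ℕ) (v : Fin N → ℝ) :
    ((P * S * Pᵀ) ^ k).mulVec (P.mulVec v) = P.mulVec ((S ^ k).mulVec v) := by
  have hSP : SemiconjBy P S (P * S * Pᵀ) := by
    simp [SemiconjBy, Matrix.mul_assoc, hP]
  rw [Matrix.mulVec_mulVec, Matrix.mulVec_mulVec, (hSP.pow_right k).eq]

/-- Every feature signal of every layer is permutation equivariant. -/
theorem gnnFeat_permutation_equivariant {N : ℕ} (S : Matrix (Fin N) (Fin N) ℝ)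
    (x : Fin N → ℝ) (σ : ℝ → ℝ) (K : ℕ) (F : ℕ → ℕ) (h : ℕ → ℕ → ℕ → ℕ → ℝ)
    {P : Matrix (Fin N) (Fin N) ℝ} (hP : IsPermMatrix P) (ℓ f : ℕ) :
    gnnFeat (P * S * Pᵀ) σ K F h (P.mulVec x) ℓ f =
      P.mulVec (gnnFeat S σ K F h x ℓ f) := by
  induction ℓ generalizing f with
  | zero => simp only [gnnFeat]
  | succ ℓ ih =>
    have hPP := hP.transpose_mul_self
    obtain ⟨π, hπ⟩ := hP
    simp only [gnnFeat, ih, conj_pow_mulVec hPP]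
    simp only [mulVec_eq_comp_of_perm hπ]
    funext i
    simp [Finset.sum_apply]

/-- Permutation equivariance of GNNs: `Φ(Px, PSPᵀ, ℋ) = P Φ(x, S, ℋ)`. -/
theorem gnn_permutation_equivariant {N : ℕ} (S : Matrix (Fin N) (Fin N) ℝ)
    (x : Fin N → ℝ) (σ : ℝ → ℝ) (K L : ℕ) (F : ℕ → ℕ) (hF0 : F 0 = 1) (hFL : F L = 1)
    (h : ℕ → ℕ → ℕ → ℕ → ℝ) (P : Matrix (Fin N) (Fin N) ℝ) (hP : IsPermMatrix P) :
    gnnOutput (P * S * Pᵀ) σ K L F h (P.mulVec x) =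
      P.mulVec (gnnOutput S σ K L F h x) := by
  exact gnnFeat_permutation_equivariant S x σ K F h hP L 0
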